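/- For every δ > 0 there is a constant C = C(𝔻₀, δ) such that for all integers Q ≥ 2, |S_Q − π r₀²/6| ≤ C · Q^{−1/10+δ}. -/

import Mathlib

open MeasureTheory Real

/-- `L_{P,P'}(x,y) = (a'-y)(q-x) - (a-y)(q'-x)` for `P = (q,a)`, `P' = (q',a')`. -/
def Lfun (P P' : ℤ × ℤ) (x y : ℝ) : ℝ :=
  ((P'.2 : ℝ) - y) * ((P.1 : ℝ) - x) - ((P.2 : ℝ) - y) * ((P'.1 : ℝ) - x)

/-- `‖PP'‖`, the Euclidean distance between the lattice points `P` and `P'`. -/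
noncomputable def distPP (P P' : ℤ × ℤ) : ℝ :=
  Real.sqrt (((P'.1 : ℝ) - (P.1 : ℝ)) ^ 2 + ((P'.2 : ℝ) - (P.2 : ℝ)) ^ 2)

open scoped Classical in
/-- The sum `S_Q` of Section 4: the sum over `0 < a < a' ≤ Q`, `0 < q < q' ≤ Q` with
`a' - a ≤ q' - q` and `r₀‖PP'‖ > |L_{P,P'}(x₀,y₀)|` of
`q q' √(r₀²‖PP'‖² - L_{P,P'}(x₀,y₀)²)/(q'-q)²`, multiplied by `2/Q⁴`. -/
noncomputable def SQ (x0 y0 r0 : ℝ) (Q : ℕ) : ℝ :=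
  (2 / (Q : ℝ) ^ 4) *
    ∑ q ∈ Finset.Icc (1 : ℤ) (Q : ℤ), ∑ q' ∈ Finset.Icc (1 : ℤ) (Q : ℤ),
      ∑ a ∈ Finset.Icc (1 : ℤ) (Q : ℤ), ∑ a' ∈ Finset.Icc (1 : ℤ) (Q : ℤ),
        if q < q' ∧ a < a' ∧ a' - a ≤ q' - q ∧
            |Lfun (q, a) (q', a') x0 y0| < r0 * distPP (q, a) (q', a') then
          (q : ℝ) * (q' : ℝ) *
              Real.sqrt (r0 ^ 2 * distPP (q, a) (q', a') ^ 2 -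
                Lfun (q, a) (q', a') x0 y0 ^ 2) / ((q' : ℝ) - (q : ℝ)) ^ 2
        else 0

theorem abs_sqrt_sub_sqrt_le (u v : ℝ) : |√u - √v| ≤ √|u - v| := by
  have key : ∀ u v : ℝ, √u - √v ≤ √|u - v| := by
    intro u v
    rw [sub_le_iff_le_add]
    rcases le_total v 0 with hv | hv
    · rw [Real.sqrt_eq_zero_of_nonpos hv, add_zero]
      apply Real.sqrt_le_sqrt
      exact le_trans (by linarith) (le_abs_self _)
    · rw [Real.sqrt_le_left (by positivity)]
      have h1 := Real.sq_sqrt hv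
      have h2 := Real.sq_sqrt (abs_nonneg (u - v))
      have h3 := le_abs_self (u - v)
      nlinarith [mul_nonneg (Real.sqrt_nonneg |u - v|) (Real.sqrt_nonneg v)]
  rw [abs_le]
  constructor
  · have := key v u
    rw [abs_sub_comm] at this
    linarith
  · exact key u v

theorem sqrt_sub_sq_eq_clip {c : ℝ} (hc : 0 ≤ c) (z : ℝ) :
    √(c - z ^ 2) = √(c - (min |z| √c) ^ 2) := by
  rcases le_total |z| √c with h | h
  · rw [min_eq_left h, sq_abs]
  · rw [min_eq_right h, Real.sq_sqrt hc, sub_self, Real.sqrt_zero]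
    apply Real.sqrt_eq_zero_of_nonpos
    have : (√c) ^ 2 ≤ |z| ^ 2 := by gcongr
    rw [Real.sq_sqrt hc, sq_abs] at this
    linarith

theorem abs_sqrt_sub_sq_sub_le {c : ℝ} (hc : 0 ≤ c) (z w : ℝ) :
    |√(c - z ^ 2) - √(c - w ^ 2)| ≤ √(2 * √c) * √|z - w| := by
  rw [sqrt_sub_sq_eq_clip hc z, sqrt_sub_sq_eq_clip hc w, ← Real.sqrt_mul (by positivity)]
  refine (abs_sqrt_sub_sqrt_le _ _).trans (Real.sqrt_le_sqrt ?_)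
  have h1 : |min |z| √c - min |w| √c| ≤ |z - w| := by
    refine (abs_min_sub_min_le_max _ _ _ _).trans ?_
    rw [sub_self, abs_zero, max_eq_left (abs_nonneg _)]
    exact abs_abs_sub_abs_le z w
  have h2 : min |z| √c ≤ √c := min_le_right _ _
  have h3 : min |w| √c ≤ √c := min_le_right _ _
  have h4 : 0 ≤ min |z| √c := le_min (abs_nonneg _) (Real.sqrt_nonneg _)
  have h5 : 0 ≤ min |w| √c := le_min (abs_nonneg _) (Real.sqrt_nonneg _)
  rw [show c - min |z| √c ^ 2 - (c - min |w| √c ^ 2)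
    = -((min |z| √c + min |w| √c) * (min |z| √c - min |w| √c)) by ring, abs_neg, abs_mul,
    abs_of_nonneg (by positivity)]
  gcongr
  linarith

theorem sqrt_sub_sq_eq_zero {c z : ℝ} (h : √c ≤ |z|) : √(c - z ^ 2) = 0 := by
  apply Real.sqrt_eq_zero_of_nonpos
  rw [Real.sqrt_le_left (abs_nonneg _), sq_abs] at h
  linarith

/-- The periodization of the half-disc profile `z ↦ √(c - z²)`. -/
noncomputable def periodizedProfile (c s : ℝ) : ℝ := ∑' a : ℤ, √(c - ((a : ℝ) - s) ^ 2)

theorem periodizedProfile_eq_sum {c s : ℝ} {A : Finset ℤ}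
    (hA : ∀ a : ℤ, a ∉ A → √c ≤ |(a : ℝ) - s|) :
    periodizedProfile c s = ∑ a ∈ A, √(c - ((a : ℝ) - s) ^ 2) :=
  tsum_eq_sum fun a ha => sqrt_sub_sq_eq_zero (hA a ha)

theorem sqrt_le_abs_of_notMem_Icc {c s : ℝ} {n : ℝ} (hn : √c ≤ n) {a : ℤ}
    (ha : a ∉ Finset.Icc ⌈s - n⌉ ⌊s + n⌋) : √c ≤ |(a : ℝ) - s| := by
  rw [Finset.mem_Icc, not_and_or, not_le, not_le, Int.lt_ceil, Int.floor_lt] at ha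
  rcases ha with h | h
  · rw [le_abs]; right; linarith
  · rw [le_abs]; left; linarith

theorem sum_le_periodizedProfile (c s : ℝ) (A : Finset ℤ) :
    ∑ a ∈ A, √(c - ((a : ℝ) - s) ^ 2) ≤ periodizedProfile c s := by
  rw [periodizedProfile_eq_sum (A := A ∪ Finset.Icc ⌈s - √c⌉ ⌊s + √c⌋)]
  · exact Finset.sum_le_sum_of_subset_of_nonneg Finset.subset_union_left
      fun _ _ _ => Real.sqrt_nonneg _
  · intro a ha
    exact sqrt_le_abs_of_notMem_Icc le_rfl fun h => ha (Finset.mem_union_right _ h)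

theorem periodizedProfile_periodic (c : ℝ) : Function.Periodic (periodizedProfile c) 1 := by
  intro s
  unfold periodizedProfile
  rw [← (Equiv.addRight (1 : ℤ)).tsum_eq]
  congr 1
  ext a
  simp

theorem abs_periodizedProfile_sub_le {c : ℝ} (hc : 0 ≤ c) {u v : ℝ} (huv : |u - v| ≤ 1) :
    |periodizedProfile c u - periodizedProfile c v|
      ≤ (2 * √c + 3) * √(2 * √c) * √|u - v| := by
  have hu := periodizedProfile_eq_sum (c := c) (s := u)
    (A := Finset.Icc ⌈u - (√c + 1)⌉ ⌊u + (√c + 1)⌋)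
    (fun a ha => sqrt_le_abs_of_notMem_Icc (by linarith) ha)
  have hv := periodizedProfile_eq_sum (c := c) (s := v)
    (A := Finset.Icc ⌈u - (√c + 1)⌉ ⌊u + (√c + 1)⌋) (by
      intro a ha
      rw [Finset.mem_Icc, not_and_or, not_le, not_le, Int.lt_ceil, Int.floor_lt] at ha
      have := abs_le.1 huv
      rcases ha with h | h
      · rw [le_abs]; right; linarith
      · rw [le_abs]; left; linarith)
  rw [hu, hv, ← Finset.sum_sub_distrib]
  refine (Finset.abs_sum_le_sum_abs _ _).trans ?_
  have h1 : ∀ a ∈ Finset.Icc ⌈u - (√c + 1)⌉ ⌊u + (√c + 1)⌋,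
      |√(c - ((a : ℝ) - u) ^ 2) - √(c - ((a : ℝ) - v) ^ 2)| ≤ √(2 * √c) * √|u - v| := by
    intro a _
    refine (abs_sqrt_sub_sq_sub_le hc _ _).trans ?_
    rw [show (a : ℝ) - u - (a - v) = v - u by ring, abs_sub_comm]
  refine (Finset.sum_le_card_nsmul _ _ _ h1).trans ?_
  rw [nsmul_eq_mul, mul_assoc]
  gcongr
  rw [Int.card_Icc]
  have h2 : ((⌊u + (√c + 1)⌋ + 1 - ⌈u - (√c + 1)⌉ : ℤ) : ℝ) ≤ 2 * √c + 3 := by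
    push_cast
    have := Int.floor_le (u + (√c + 1))
    have := Int.le_ceil (u - (√c + 1))
    linarith
  have h3 : (0:ℝ) ≤ 2 * √c + 3 := by positivity
  have h4 : (((⌊u + (√c + 1)⌋ + 1 - ⌈u - (√c + 1)⌉).toNat : ℤ) : ℝ) ≤ 2 * √c + 3 := by
    rw [Int.toNat_eq_max]
    push_cast at h2 ⊢
    exact max_le h2 h3
  exact_mod_cast h4

theorem integral_sqrt_sub_sq {c : ℝ} (hc : 0 ≤ c) : ∫ x, √(c - x ^ 2) = π * c / 2 := by
  rcases hc.eq_or_lt with rfl | hc'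
  · have : ∀ x : ℝ, √(0 - x ^ 2) = 0 := fun x => Real.sqrt_eq_zero_of_nonpos (by nlinarith)
    simp only [this, integral_zero, mul_zero, zero_div]
  have hR : 0 < √c := Real.sqrt_pos.2 hc'
  have h2 : ∫ x in (-√c)..√c, √(c - x ^ 2) = π * c / 2 := by
    have h := intervalIntegral.integral_comp_mul_right (a := -1) (b := 1)
      (fun x => √(c - x ^ 2)) hR.ne'
    simp only [neg_mul, one_mul, smul_eq_mul] at h
    have h3 : ∀ x : ℝ, √(c - (x * √c) ^ 2) = √c * √(1 - x ^ 2) := by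
      intro x
      rw [← Real.sqrt_mul hc, mul_pow, Real.sq_sqrt hc]
      congr 1; ring
    simp only [h3] at h
    rw [intervalIntegral.integral_const_mul, integral_sqrt_one_sub_sq] at h
    field_simp at h
    rw [Real.sq_sqrt hc] at h
    linarith
  rw [← h2]
  symm
  apply intervalIntegral.integral_eq_integral_of_support_subset
  intro x hx
  by_contra hx'
  apply hx
  apply sqrt_sub_sq_eq_zero
  rw [Set.mem_Ioc, not_and_or, not_lt, not_le] at hx'
  rw [le_abs]
  rcases hx' with h | h
  · right; linarith
  · left; linarith

theorem integral_periodizedProfile {c : ℝ} (hc : 0 ≤ c) :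
    ∫ s in (0:ℝ)..1, periodizedProfile c s = π * c / 2 := by
  have hcont : Continuous fun x : ℝ => √(c - x ^ 2) := by fun_prop
  have hint : Integrable fun x : ℝ => √(c - x ^ 2) := by
    apply hcont.integrable_of_hasCompactSupport
    apply HasCompactSupport.intro (isCompact_Icc (a := -√c) (b := √c))
    intro x hx
    apply sqrt_sub_sq_eq_zero
    rw [Set.mem_Icc, not_and_or, not_le, not_le] at hx
    rw [le_abs]
    rcases hx with h | h
    · right; linarith
    · left; linarith
  have h1 := hint.hasSum_intervalIntegral_comp_add_int
  rw [integral_sqrt_sub_sq hc] at h1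
  rw [← h1.tsum_eq, ← (Equiv.neg ℤ).tsum_eq]
  have hz : ∀ a : ℤ, a ∉ Finset.Icc ⌈(0:ℝ) - (√c + 1)⌉ ⌊(0:ℝ) + (√c + 1)⌋ →
      ∀ s ∈ Set.uIcc (0:ℝ) 1, √c ≤ |(a : ℝ) - s| := by
    intro a ha s hs
    rw [Set.uIcc_of_le zero_le_one] at hs
    obtain ⟨hs0, hs1⟩ := hs
    rw [Finset.mem_Icc, not_and_or, not_le, not_le, Int.lt_ceil, Int.floor_lt] at ha
    rcases ha with h | h
    · rw [le_abs]; right; linarith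
    · rw [le_abs]; left; linarith
  rw [tsum_eq_sum (s := Finset.Icc ⌈(0:ℝ) - (√c + 1)⌉ ⌊(0:ℝ) + (√c + 1)⌋)]
  · rw [← intervalIntegral.integral_finsetSum]
    · apply intervalIntegral.integral_congr
      intro s hs
      simp only
      rw [periodizedProfile_eq_sum (fun a ha => hz a ha s hs)]
      apply Finset.sum_congr rfl
      intro a _
      simp only [Equiv.neg_apply, Int.cast_neg]
      congr 2
      ring
    · intro a _
      apply Continuous.intervalIntegrable
      fun_prop
  · intro a ha
    refine (intervalIntegral.integral_congr (g := fun _ => (0:ℝ)) ?_).trans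
      intervalIntegral.integral_zero
    intro s hs
    simp only [Equiv.neg_apply, Int.cast_neg]
    apply sqrt_sub_sq_eq_zero
    rw [← abs_neg]
    convert hz a ha s hs using 2
    ring

theorem Function.Periodic.sum_range_add_mul_div {F : ℝ → ℝ} (hF : Function.Periodic F 1)
    {h : ℤ} {k : ℕ} (hk : 0 < k) (hcop : IsCoprime h (k : ℤ)) (s : ℝ) :
    ∑ j ∈ Finset.range k, F (s + j * ((h : ℝ) / k)) = ∑ m ∈ Finset.range k, F (s + m / k) := by
  have hk' : (0:ℤ) < k := by exact_mod_cast hk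
  have hmod : ∀ j : ℕ, (((j * h) % (k : ℤ)).toNat : ℤ) = (j * h) % (k : ℤ) := fun j =>
    Int.toNat_of_nonneg (Int.emod_nonneg _ hk'.ne')
  have hmaps : Set.MapsTo (fun j : ℕ => ((j * h) % (k : ℤ)).toNat)
      (Finset.range k) (Finset.range k) := by
    intro j _
    simp only [Finset.coe_range, Set.mem_Iio]
    have := Int.emod_lt_of_pos (j * h) hk'
    have := hmod j
    omega
  have hinj : Set.InjOn (fun j : ℕ => ((j * h) % (k : ℤ)).toNat) (Finset.range k) := by
    intro i hi j hj hij
    simp only [Finset.coe_range, Set.mem_Iio] at hi hj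
    have h1 : (i * h) % (k : ℤ) = (j * h) % (k : ℤ) := by
      rw [← hmod i, ← hmod j]
      exact_mod_cast hij
    have h2 : (k : ℤ) ∣ ((i : ℤ) - j) * h := by
      rw [sub_mul]
      exact Int.ModEq.dvd h1.symm
    have h3 : (k : ℤ) ∣ (i : ℤ) - j := hcop.symm.dvd_of_dvd_mul_right h2
    have h4 := Int.eq_zero_of_abs_lt_dvd h3 (by rw [abs_lt]; constructor <;> omega)
    omega
  have hsurj := Finset.surjOn_of_injOn_of_card_le _ hmaps hinj le_rfl
  refine Finset.sum_nbij _ hmaps hinj hsurj ?_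
  intro j _
  have h5 : ((((j * h) % (k : ℤ)).toNat : ℕ) : ℝ) = (j : ℝ) * h - k * ((j * h / (k : ℤ) : ℤ) : ℝ) := by
    have : ((((j * h) % (k : ℤ)).toNat : ℤ) : ℝ) = (((j * h) % (k : ℤ) : ℤ) : ℝ) := by rw [hmod]
    rw [Int.emod_def] at this
    push_cast at this
    rw [Int.emod_def]
    exact_mod_cast this
  have hk0 : (k : ℝ) ≠ 0 := by positivity
  rw [h5, ← hF.int_mul ((j * h / (k : ℤ) : ℤ)) (s + (_ - _) / _)]
  congr 1
  field_simp
  ring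

theorem abs_sum_range_sub_integral_le {F : ℝ → ℝ} (hF : Function.Periodic F 1) {H : ℝ}
    (hH : ∀ u v, |u - v| ≤ 1 → |F u - F v| ≤ H * √|u - v|) (hcont : Continuous F)
    {k : ℕ} (hk : 0 < k) (s : ℝ) :
    |∑ m ∈ Finset.range k, F (s + m / k) - k * ∫ x in (0:ℝ)..1, F x| ≤ k * (H * √(1 / k)) := by
  have hk0 : (0 : ℝ) < k := by positivity
  have hH0 : 0 ≤ H := by
    have := (abs_nonneg _).trans (hH 1 0 (by simp))
    simpa using this
  have h1 : ∫ x in (0:ℝ)..1, F x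
      = ∑ m ∈ Finset.range k, ∫ x in (s + (m : ℕ) / k)..(s + (m + 1 : ℕ) / k), F x := by
    rw [intervalIntegral.sum_integral_adjacent_intervals (a := fun m : ℕ => s + (m : ℝ) / k)
      fun _ _ => hcont.intervalIntegrable _ _]
    have := hF.intervalIntegral_add_eq 0 s
    rw [zero_add] at this
    rw [this]
    congr 1
    · simp
    · field_simp
  rw [h1, Finset.mul_sum, ← Finset.sum_sub_distrib]
  refine (Finset.abs_sum_le_sum_abs _ _).trans ?_
  have h2 : ∀ m ∈ Finset.range k, |F (s + m / k) -
      k * ∫ x in (s + (m : ℕ) / k)..(s + (m + 1 : ℕ) / k), F x| ≤ H * √(1 / k) := by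
    intro m _
    have h3 : F (s + m / k) - k * ∫ x in (s + (m : ℕ) / k)..(s + (m + 1 : ℕ) / k), F x
        = k * ∫ x in (s + (m : ℕ) / k)..(s + (m + 1 : ℕ) / k), (F (s + m / k) - F x) := by
      rw [intervalIntegral.integral_sub (by simp) (hcont.intervalIntegrable _ _),
        intervalIntegral.integral_const, smul_eq_mul]
      push_cast
      field_simp
      ring
    rw [h3, abs_mul, abs_of_pos hk0]
    have h4 := intervalIntegral.norm_integral_le_of_norm_le_const
      (a := s + (m : ℕ) / k) (b := s + (m + 1 : ℕ) / k)
      (f := fun x => F (s + m / k) - F x) (C := H * √(1 / k)) (by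
        intro x hx
        have hle : s + (m : ℝ) / k ≤ s + ((m + 1 : ℕ) : ℝ) / k := by
          gcongr
          simp
        rw [Set.uIoc_of_le hle] at hx
        obtain ⟨hx1, hx2⟩ := hx
        have h5 : |s + m / k - x| ≤ 1 / k := by
          push_cast at hx2
          rw [add_div] at hx2
          have : (0:ℝ) < 1 / k := by positivity
          rw [abs_le]; constructor <;> linarith
        have h6 : (1 : ℝ) / k ≤ 1 := by
          rw [div_le_one hk0]; exact_mod_cast hk
        refine (hH _ _ (h5.trans h6)).trans ?_
        gcongr)
    rw [Real.norm_eq_abs] at h4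
    have h7 : |s + ((m + 1 : ℕ) : ℝ) / k - (s + m / k)| = 1 / k := by
      rw [show s + ((m + 1 : ℕ) : ℝ) / k - (s + m / k) = 1 / k by push_cast; ring]
      exact abs_of_pos (by positivity)
    rw [h7] at h4
    calc _ ≤ (k : ℝ) * (H * √(1 / k) * (1 / k)) := by gcongr
      _ = _ := by field_simp
  refine (Finset.sum_le_card_nsmul _ _ _ h2).trans ?_
  rw [Finset.card_range, nsmul_eq_mul]

theorem continuous_of_abs_sub_le_sqrt {F : ℝ → ℝ} {H : ℝ}
    (hH : ∀ u v, |u - v| ≤ 1 → |F u - F v| ≤ H * √|u - v|) : Continuous F := by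
  rw [continuous_iff_continuousAt]
  intro v
  rw [ContinuousAt, tendsto_iff_dist_tendsto_zero]
  have h1 : Filter.Tendsto (fun u => H * √|u - v|) (nhds v) (nhds 0) := by
    have : Continuous fun u => H * √|u - v| := by fun_prop
    simpa using this.tendsto v
  refine squeeze_zero' (Filter.Eventually.of_forall fun _ => dist_nonneg) ?_ h1
  filter_upwards [Metric.ball_mem_nhds v one_pos] with u hu
  rw [Real.dist_eq]
  apply hH
  rw [Metric.mem_ball, Real.dist_eq] at hu
  exact hu.le

theorem abs_sum_range_add_mul_sub_integral_le {F : ℝ → ℝ} (hF : Function.Periodic F 1) {H : ℝ}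
    (hH : ∀ u v, |u - v| ≤ 1 → |F u - F v| ≤ H * √|u - v|) {θ : ℝ} {p : ℚ} {K : ℕ}
    (hp : |θ - p| ≤ 1 / ((K + 1) * p.den)) (s : ℝ) :
    |∑ j ∈ Finset.range p.den, (F (s + j * θ) - ∫ x in (0:ℝ)..1, F x)|
      ≤ p.den * (H * √(1 / (K + 1)) + H * √(1 / p.den)) := by
  have hcont := continuous_of_abs_sub_le_sqrt hH
  have hden : (0:ℝ) < p.den := by exact_mod_cast p.den_pos
  have hH0 : 0 ≤ H := by
    have := (abs_nonneg _).trans (hH 1 0 (by simp))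
    simpa using this
  have hcop : IsCoprime p.num (p.den : ℤ) := by
    rw [Int.isCoprime_iff_gcd_eq_one]
    exact p.reduced
  have h1 := abs_sum_range_sub_integral_le hF hH hcont p.den_pos s
  rw [← hF.sum_range_add_mul_div p.den_pos hcop] at h1
  have hpc : (p : ℝ) = (p.num : ℝ) / p.den := by exact_mod_cast (Rat.num_div_den p).symm
  rw [← hpc] at h1
  have h2 : |∑ j ∈ Finset.range p.den, (F (s + j * θ) - F (s + j * p))|
      ≤ p.den * (H * √(1 / (K + 1))) := by
    refine (Finset.abs_sum_le_sum_abs _ _).trans ?_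
    have : ∀ j ∈ Finset.range p.den, |F (s + j * θ) - F (s + j * p)| ≤ H * √(1 / (K + 1)) := by
      intro j hj
      have hj' : (j : ℝ) ≤ p.den := by exact_mod_cast (Finset.mem_range.1 hj).le
      have h3 : |s + j * θ - (s + j * p)| ≤ 1 / (K + 1) := by
        rw [show s + j * θ - (s + j * p) = j * (θ - p) by ring, abs_mul, Nat.abs_cast]
        calc (j : ℝ) * |θ - p| ≤ p.den * (1 / ((K + 1) * p.den)) := by gcongr
          _ = _ := by field_simp
      have h4 : (1 : ℝ) / (K + 1) ≤ 1 := by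
        rw [div_le_one (by positivity)]
        have : (0:ℝ) ≤ K := by positivity
        linarith
      refine (hH _ _ (h3.trans h4)).trans ?_
      gcongr
    refine (Finset.sum_le_card_nsmul _ _ _ this).trans ?_
    rw [Finset.card_range, nsmul_eq_mul]
  have h5 : ∑ j ∈ Finset.range p.den, (F (s + j * θ) - ∫ x in (0:ℝ)..1, F x)
      = ∑ j ∈ Finset.range p.den, (F (s + j * θ) - F (s + j * p))
        + (∑ j ∈ Finset.range p.den, F (s + j * p) - p.den * ∫ x in (0:ℝ)..1, F x) := by
    simp only [Finset.sum_sub_distrib, Finset.sum_const, Finset.card_range, nsmul_eq_mul]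
    ring
  rw [h5, mul_add]
  exact (abs_add_le _ _).trans (add_le_add h2 h1)

theorem abs_sub_integral_le {F : ℝ → ℝ} (hF : Function.Periodic F 1) {H : ℝ}
    (hH : ∀ u v, |u - v| ≤ 1 → |F u - F v| ≤ H * √|u - v|) (s : ℝ) :
    |F s - ∫ x in (0:ℝ)..1, F x| ≤ H := by
  simpa using abs_sum_range_sub_integral_le hF hH (continuous_of_abs_sub_le_sqrt hH) one_pos s

theorem abs_sum_range_le_of_block {g : ℕ → ℝ} {B ε : ℝ} {k : ℕ} (hk : 0 < k)
    (hB : ∀ i, |g i| ≤ B) (hε : ∀ m, |∑ j ∈ Finset.range k, g (m + j)| ≤ k * ε) (n : ℕ) :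
    |∑ i ∈ Finset.range n, g i| ≤ n * ε + k * B := by
  have hB0 : 0 ≤ B := (abs_nonneg _).trans (hB 0)
  have hk0 : (0 : ℝ) < k := by positivity
  have hε0 : 0 ≤ ε := by
    have := (abs_nonneg _).trans (hε 0)
    exact nonneg_of_mul_nonneg_right this hk0
  induction n using Nat.strong_induction_on with
  | _ n ih =>
    rcases lt_or_ge n k with h | h
    · refine (Finset.abs_sum_le_sum_abs _ _).trans ?_
      refine (Finset.sum_le_card_nsmul _ _ _ fun i _ => hB i).trans ?_
      rw [Finset.card_range, nsmul_eq_mul]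
      have : (n : ℝ) * B ≤ k * B := by gcongr
      have : 0 ≤ n * ε := by positivity
      linarith
    · obtain ⟨m, rfl⟩ := Nat.exists_eq_add_of_le h
      rw [add_comm k m, Finset.sum_range_add]
      refine (abs_add_le _ _).trans ?_
      have h1 := ih m (by omega)
      have h2 := hε m
      push_cast
      linarith

theorem abs_sum_range_mul_le_of_monotone {w g : ℕ → ℝ} {X : ℝ} (hw : Monotone w)
    (hw0 : 0 ≤ w 0) (n : ℕ) (hX : ∀ m ≤ n, |∑ i ∈ Finset.range m, g i| ≤ X) :
    |∑ i ∈ Finset.range n, w i * g i| ≤ 2 * w n * X := by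
  have hid : ∀ n, ∑ i ∈ Finset.range n, w i * g i = w n * ∑ i ∈ Finset.range n, g i
      - ∑ i ∈ Finset.range n, (w (i + 1) - w i) * ∑ j ∈ Finset.range (i + 1), g j := by
    intro n
    induction n with
    | zero => simp
    | succ n ih =>
      rw [Finset.sum_range_succ, ih, Finset.sum_range_succ (fun i => (w (i + 1) - w i) * _),
        Finset.sum_range_succ g]
      ring
  have hX0 : 0 ≤ X := (abs_nonneg _).trans (hX 0 (Nat.zero_le _))
  have hwn : 0 ≤ w n := hw0.trans (hw (Nat.zero_le _))
  have h1 : |w n * ∑ i ∈ Finset.range n, g i| ≤ w n * X := by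
    rw [abs_mul, abs_of_nonneg hwn]
    have := hX n le_rfl
    gcongr
  have h2 : |∑ i ∈ Finset.range n, (w (i + 1) - w i) * ∑ j ∈ Finset.range (i + 1), g j|
      ≤ (w n - w 0) * X := by
    refine (Finset.abs_sum_le_sum_abs _ _).trans ?_
    rw [← Finset.sum_range_sub, Finset.sum_mul]
    apply Finset.sum_le_sum
    intro i hi
    have h3 : 0 ≤ w (i + 1) - w i := sub_nonneg.2 (hw (Nat.le_succ i))
    rw [abs_mul, abs_of_nonneg h3]
    have := hX (i + 1) (Finset.mem_range.1 hi)
    gcongr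
  rw [hid]
  refine (abs_sub _ _).trans ?_
  nlinarith [mul_nonneg hw0 hX0]

theorem sum_Icc_ite_eq_sum_sum_Icc_sub {Q D : ℤ} (g : ℤ → ℤ → ℝ) :
    (∑ a ∈ Finset.Icc 1 Q, ∑ a' ∈ Finset.Icc 1 Q, if a < a' ∧ a' - a ≤ D then g a a' else 0)
      = ∑ b ∈ Finset.Icc 1 D, ∑ a ∈ Finset.Icc 1 (Q - b), g a (a + b) := by
  rw [← Finset.sum_product', ← Finset.sum_filter, Finset.sum_sigma']
  refine Finset.sum_nbij' (fun p => ⟨p.2 - p.1, p.1⟩) (fun p => (p.2, p.2 + p.1)) ?_ ?_ ?_ ?_ ?_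
  · rintro ⟨a, a'⟩ h
    simp only [Finset.mem_filter, Finset.mem_product, Finset.mem_Icc, Finset.mem_sigma] at h ⊢
    omega
  · rintro ⟨b, a⟩ h
    simp only [Finset.mem_filter, Finset.mem_product, Finset.mem_Icc, Finset.mem_sigma] at h ⊢
    omega
  · rintro ⟨a, a'⟩ _
    simp
  · rintro ⟨b, a⟩ _
    simp
  · rintro ⟨a, a'⟩ _
    simp

theorem sum_Icc_one_cast {g : ℤ → ℝ} (n : ℕ) :
    ∑ q ∈ Finset.Icc (1 : ℤ) n, g q = ∑ i ∈ Finset.range n, g (i + 1) := by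
  refine Finset.sum_nbij' (fun q => (q - 1).toNat) (fun i => (i : ℤ) + 1) ?_ ?_ ?_ ?_ ?_
  · intro q h
    simp only [Finset.mem_Icc, Finset.mem_range] at h ⊢
    omega
  · intro q h
    simp only [Finset.mem_Icc, Finset.mem_range] at h ⊢
    omega
  · intro q h
    simp only [Finset.mem_Icc] at h ⊢
    omega
  · intro q h
    simp
  · intro q h
    simp only [Finset.mem_Icc] at h
    congr 1
    omega

theorem sum_Icc_one_div_le (n : ℕ) : ∑ d ∈ Finset.Icc (1 : ℤ) n, 1 / (d : ℝ) ≤ 2 * √n := by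
  rw [sum_Icc_one_cast]
  induction n with
  | zero => simp
  | succ n ih =>
    rw [Finset.sum_range_succ]
    push_cast at ih ⊢
    have h1 := Real.sq_sqrt (show (0:ℝ) ≤ n by positivity)
    have h2 := Real.sq_sqrt (show (0:ℝ) ≤ (n:ℝ) + 1 by positivity)
    have h3 : √(n:ℝ) ≤ √((n:ℝ) + 1) := Real.sqrt_le_sqrt (by linarith)
    have h4 : 1 / ((n:ℝ) + 1) ≤ 2 * √((n:ℝ) + 1) - 2 * √(n:ℝ) := by
      rw [div_le_iff₀ (by positivity)]
      have h5 : 1 ≤ √((n:ℝ) + 1) := by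
        rw [Real.one_le_sqrt]; linarith [show (0:ℝ) ≤ n by positivity]
      have h6 : (√((n:ℝ) + 1) - √n) * (√((n:ℝ) + 1) + √n) = 1 := by linear_combination h2 - h1
      have h7 : √((n:ℝ) + 1) + √n ≤ 2 * ((n:ℝ) + 1) := by nlinarith
      nlinarith
    linarith

theorem sum_Icc_one_add_div_sq {d : ℤ} (hd : 1 ≤ d) :
    ∑ b ∈ Finset.Icc 1 d, (1 + ((b : ℝ) / (d : ℝ)) ^ 2) =
      4 * (d : ℝ) / 3 + 1 / 2 + 1 / (6 * (d : ℝ)) := by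
  lift d to ℕ using by omega
  have hsum : ∀ n : ℕ, ∑ i ∈ Finset.range n, (((i : ℤ) + 1 : ℤ) : ℝ) ^ 2
      = (n : ℝ) * (n + 1) * (2 * n + 1) / 6 := by
    intro n
    induction n with
    | zero => simp
    | succ n ih =>
      rw [Finset.sum_range_succ, ih]
      push_cast
      ring
  rw [sum_Icc_one_cast]
  simp only [div_pow, Finset.sum_add_distrib, Finset.sum_const, Finset.card_range, nsmul_eq_mul,
    ← Finset.sum_div]
  rw [hsum]
  have : (d : ℝ) ≠ 0 := by
    have : 0 < d := by omega
    positivity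
  push_cast
  field_simp
  ring

theorem sum_Icc_mul_add {n d : ℤ} (hn : 0 ≤ n) :
    ∑ q ∈ Finset.Icc 1 n, (q : ℝ) * (q + d) =
      (n : ℝ) * (n + 1) * (2 * n + 1) / 6 + d * n * (n + 1) / 2 := by
  lift n to ℕ using hn
  rw [sum_Icc_one_cast]
  induction n with
  | zero => simp
  | succ n ih =>
    rw [Finset.sum_range_succ, ih]
    push_cast
    ring

theorem sum_sum_Icc_mul_add (Q : ℕ) :
    ∑ d ∈ Finset.Icc (1 : ℤ) Q, ∑ q ∈ Finset.Icc 1 (Q - d), (q : ℝ) * (q + d)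
      = ((Q : ℝ) - 1) * Q * (Q + 1) * (3 * Q + 2) / 24 := by
  have h1 : ∀ d ∈ Finset.Icc (1 : ℤ) Q, ∑ q ∈ Finset.Icc 1 (Q - d), (q : ℝ) * (q + d)
      = ((Q : ℝ) - d) * (Q - d + 1) * (2 * (Q - d) + 1) / 6 + d * (Q - d) * (Q - d + 1) / 2 := by
    intro d hd
    rw [Finset.mem_Icc] at hd
    rw [sum_Icc_mul_add (by omega)]
    push_cast
    ring
  rw [Finset.sum_congr rfl h1, sum_Icc_one_cast]
  have h2 : ∀ (P : ℝ) (n : ℕ), ∑ i ∈ Finset.range n,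
      ((P - ((i + 1 : ℤ) : ℝ)) * (P - ((i + 1 : ℤ) : ℝ) + 1) * (2 * (P - ((i + 1 : ℤ) : ℝ)) + 1) / 6
        + ((i + 1 : ℤ) : ℝ) * (P - ((i + 1 : ℤ) : ℝ)) * (P - ((i + 1 : ℤ) : ℝ) + 1) / 2)
      = (n * (P * (P + 1) * (2 * P + 1)) + (P ^ 2 + P - (2 * P + 1) ^ 2) * (n * (n + 1) / 2)
        + (n : ℝ) ^ 2 * (n + 1) ^ 2 / 4) / 6 := by
    intro P n
    induction n with
    | zero => simp
    | succ n ih =>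
      rw [Finset.sum_range_succ, ih]
      push_cast
      ring
  rw [h2]
  ring

theorem abs_sum_mul_periodizedProfile_sub_le {c H : ℝ} (hc : 0 ≤ c)
    (hH : (2 * √c + 3) * √(2 * √c) ≤ H) {θ : ℝ} {p : ℚ} {K : ℕ}
    (hp : |θ - p| ≤ 1 / ((K + 1) * p.den)) (hK : p.den ≤ K) {n d : ℤ} (hn : 0 ≤ n) (hd : 0 ≤ d)
    (s : ℝ) :
    |∑ q ∈ Finset.Icc 1 n, (q : ℝ) * (q + d) * (periodizedProfile c (s + q * θ) - π * c / 2)|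
      ≤ 2 * ((n + 1) * (n + 1 + d)) * (n * (H * √(1 / (K + 1)) + H * √(1 / p.den)) + K * H) := by
  have hper := periodizedProfile_periodic c
  have hHol : ∀ u v, |u - v| ≤ 1 →
      |periodizedProfile c u - periodizedProfile c v| ≤ H * √|u - v| := by
    intro u v huv
    refine (abs_periodizedProfile_sub_le hc huv).trans ?_
    gcongr
  have hH0 : 0 ≤ H := le_trans (by positivity) hH
  lift n to ℕ using hn
  rw [sum_Icc_one_cast]
  have hblock := abs_sum_range_le_of_block p.den_pos
    (g := fun i : ℕ => periodizedProfile c (s + ((i + 1 : ℤ) : ℝ) * θ) - π * c / 2)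
    (B := H) (ε := H * √(1 / (K + 1)) + H * √(1 / p.den))
    (by
      intro i
      have := abs_sub_integral_le hper hHol (s + ((i + 1 : ℤ) : ℝ) * θ)
      rwa [integral_periodizedProfile hc] at this)
    (by
      intro m
      have := abs_sum_range_add_mul_sub_integral_le hper hHol hp (s + (m + 1) * θ)
      rw [integral_periodizedProfile hc] at this
      convert this using 5
      push_cast
      ring)
  have h := abs_sum_range_mul_le_of_monotone
    (w := fun i : ℕ => ((i + 1 : ℤ) : ℝ) * (((i + 1 : ℤ) : ℝ) + d))
    (g := fun i : ℕ => periodizedProfile c (s + ((i + 1 : ℤ) : ℝ) * θ) - π * c / 2)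
    (X := n * (H * √(1 / (K + 1)) + H * √(1 / p.den)) + K * H)
    (by
      have hd' : (0 : ℝ) ≤ d := by exact_mod_cast hd
      intro i j hij
      have hij' : (i : ℝ) ≤ j := by exact_mod_cast hij
      have : (0:ℝ) ≤ i := by positivity
      push_cast
      gcongr)
    (by
      have hd' : (0 : ℝ) ≤ d := by exact_mod_cast hd
      push_cast
      positivity)
    n
    (by
      intro m hm
      refine (hblock m).trans ?_
      have hK' : (p.den : ℝ) ≤ K := by exact_mod_cast hK
      gcongr)
  push_cast at h ⊢
  exact h

theorem sqrt_strip_div {x y r : ℝ} {d b q a : ℤ} (hd : 1 ≤ d) :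
    √(r ^ 2 * distPP (q, a) (q + d, a + b) ^ 2 - Lfun (q, a) (q + d, a + b) x y ^ 2)
      / (((q + d : ℤ) : ℝ) - q) ^ 2
    = 1 / d * √(r ^ 2 * (1 + ((b : ℝ) / (d : ℝ)) ^ 2)
        - ((a : ℝ) - (y + (b : ℝ) / (d : ℝ) * (q - x))) ^ 2) := by
  have hd0 : (0 : ℝ) < d := by exact_mod_cast hd
  unfold distPP Lfun
  rw [Real.sq_sqrt (by positivity)]
  have h1 : r ^ 2 * ((((q + d : ℤ) : ℝ) - q) ^ 2 + (((a + b : ℤ) : ℝ) - a) ^ 2)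
      - ((((a + b : ℤ) : ℝ) - y) * (q - x) - (a - y) * (((q + d : ℤ) : ℝ) - x)) ^ 2
      = (d : ℝ) ^ 2 * (r ^ 2 * (1 + ((b : ℝ) / (d : ℝ)) ^ 2)
        - ((a : ℝ) - (y + (b : ℝ) / (d : ℝ) * (q - x))) ^ 2) := by
    push_cast
    field_simp
    ring
  simp only
  rw [h1, Real.sqrt_mul (by positivity), Real.sqrt_sq hd0.le]
  push_cast
  rw [add_sub_cancel_left]
  field_simp

theorem SQ_eq (x y r : ℝ) (hr : 0 < r) (Q : ℕ) :
    SQ x y r Q = 2 / (Q : ℝ) ^ 4 * ∑ d ∈ Finset.Icc (1 : ℤ) Q, ∑ b ∈ Finset.Icc 1 d,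
      ∑ q ∈ Finset.Icc 1 ((Q : ℤ) - d), ∑ a ∈ Finset.Icc 1 ((Q : ℤ) - b),
        (q : ℝ) * (q + d) * (1 / d * √(r ^ 2 * (1 + ((b : ℝ) / (d : ℝ)) ^ 2)
          - ((a : ℝ) - (y + (b : ℝ) / (d : ℝ) * (q - x))) ^ 2)) := by
  unfold SQ
  congr 1
  have h1 : ∀ q q' a a' : ℤ,
      (if q < q' ∧ a < a' ∧ a' - a ≤ q' - q ∧
          |Lfun (q, a) (q', a') x y| < r * distPP (q, a) (q', a') then
        (q : ℝ) * (q' : ℝ) * √(r ^ 2 * distPP (q, a) (q', a') ^ 2 -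
          Lfun (q, a) (q', a') x y ^ 2) / ((q' : ℝ) - (q : ℝ)) ^ 2
        else 0) =
      if q < q' then (if a < a' ∧ a' - a ≤ q' - q then
        (q : ℝ) * (q' : ℝ) * (√(r ^ 2 * distPP (q, a) (q', a') ^ 2 -
          Lfun (q, a) (q', a') x y ^ 2) / ((q' : ℝ) - (q : ℝ)) ^ 2) else 0) else 0 := by
    intro q q' a a'
    by_cases hL : |Lfun (q, a) (q', a') x y| < r * distPP (q, a) (q', a')
    · by_cases hq : q < q' <;> by_cases ha : a < a' <;> by_cases hqa : a' - a ≤ q' - q <;>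
        simp [hL, hq, ha, hqa, mul_div_assoc]
    · have h0 : √(r ^ 2 * distPP (q, a) (q', a') ^ 2 - Lfun (q, a) (q', a') x y ^ 2) = 0 := by
        rw [← mul_pow]
        apply Real.sqrt_eq_zero_of_nonpos
        rw [sub_nonpos, sq_le_sq]
        refine le_trans (le_of_eq (abs_of_nonneg ?_)) (not_lt.1 hL)
        exact mul_nonneg hr.le (Real.sqrt_nonneg _)
      simp [hL, h0]
  simp only [h1]
  have h2 : ∀ q ∈ Finset.Icc (1 : ℤ) Q, ∀ q' ∈ Finset.Icc (1 : ℤ) Q,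
      (∑ a ∈ Finset.Icc (1 : ℤ) Q, ∑ a' ∈ Finset.Icc (1 : ℤ) Q,
        if q < q' then (if a < a' ∧ a' - a ≤ q' - q then
        (q : ℝ) * (q' : ℝ) * (√(r ^ 2 * distPP (q, a) (q', a') ^ 2 -
          Lfun (q, a) (q', a') x y ^ 2) / ((q' : ℝ) - (q : ℝ)) ^ 2) else 0) else 0)
      = if q < q' ∧ q' - q ≤ Q then ∑ b ∈ Finset.Icc 1 (q' - q),
          ∑ a ∈ Finset.Icc 1 ((Q : ℤ) - b), (q : ℝ) * (q' : ℝ) *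
          (√(r ^ 2 * distPP (q, a) (q', a + b) ^ 2 - Lfun (q, a) (q', a + b) x y ^ 2)
            / ((q' : ℝ) - (q : ℝ)) ^ 2) else 0 := by
    intro q hq q' hq'
    rw [Finset.mem_Icc] at hq hq'
    have hle : q' - q ≤ Q := by omega
    by_cases hlt : q < q'
    · simp only [hlt, hle, if_true, and_self]
      exact sum_Icc_ite_eq_sum_sum_Icc_sub _
    · simp [hlt]
  rw [Finset.sum_congr rfl fun q hq => Finset.sum_congr rfl (h2 q hq)]
  rw [sum_Icc_ite_eq_sum_sum_Icc_sub]
  apply Finset.sum_congr rfl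
  intro d hd
  rw [Finset.mem_Icc] at hd
  simp only [add_sub_cancel_left]
  rw [Finset.sum_comm]
  refine Finset.sum_congr rfl fun b _ => Finset.sum_congr rfl fun q _ =>
    Finset.sum_congr rfl fun a _ => ?_
  rw [sqrt_strip_div hd.1]
  push_cast
  ring

/-- Weighted deviation between the sums over lattice points in a strip of slope `t` and the
corresponding integrals. -/
noncomputable def stripDeviation (x y c t : ℝ) (d n m : ℤ) : ℝ :=
  ∑ q ∈ Finset.Icc 1 n, (q : ℝ) * (q + d) *
    (∑ a ∈ Finset.Icc 1 m, √(c - ((a : ℝ) - (y + t * (q - x))) ^ 2) - π * c / 2)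

theorem periodizedProfile_le {c H : ℝ} (hc : 0 ≤ c) (hH : (2 * √c + 3) * √(2 * √c) ≤ H) (s : ℝ) :
    periodizedProfile c s ≤ π * c / 2 + H := by
  have h := abs_sub_integral_le (periodizedProfile_periodic c) (H := H) (fun u v huv => by
    refine (abs_periodizedProfile_sub_le hc huv).trans ?_
    gcongr) s
  rw [integral_periodizedProfile hc] at h
  linarith [(abs_le.1 h).2]

theorem abs_stripDeviation_le {x y c t H B : ℝ} {d n m Q : ℤ} (hc : 0 ≤ c)
    (hH : (2 * √c + 3) * √(2 * √c) ≤ H) (hB : π * c / 2 + H ≤ B) (hd : 0 ≤ d) (hn : 0 ≤ n)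
    (hQ : n + d ≤ Q) : |stripDeviation x y c t d n m| ≤ B * (Q : ℝ) ^ 3 := by
  have hH0 : 0 ≤ H := le_trans (by positivity) hH
  have hB0 : 0 ≤ B := le_trans (by positivity) hB
  have hQ0 : (0:ℝ) ≤ Q := by exact_mod_cast (by omega : 0 ≤ Q)
  refine (Finset.abs_sum_le_sum_abs _ _).trans ?_
  have h1 : ∀ q ∈ Finset.Icc 1 n, |(q : ℝ) * (q + d) *
      (∑ a ∈ Finset.Icc 1 m, √(c - ((a : ℝ) - (y + t * (q - x))) ^ 2) - π * c / 2)|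
      ≤ Q * Q * B := by
    intro q hq
    rw [Finset.mem_Icc] at hq
    have hq0 : (0:ℝ) ≤ q := by exact_mod_cast (by omega : 0 ≤ q)
    have hd0 : (0:ℝ) ≤ d := by exact_mod_cast hd
    have hqQ : (q:ℝ) ≤ Q := by exact_mod_cast (by omega : q ≤ Q)
    have hqdQ : (q:ℝ) + d ≤ Q := by exact_mod_cast (by omega : q + d ≤ Q)
    rw [abs_mul, abs_of_nonneg (by positivity)]
    have h2 := sum_le_periodizedProfile c (y + t * (q - x)) (Finset.Icc 1 m)
    have h3 := periodizedProfile_le hc hH (y + t * (q - x))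
    have h4 : 0 ≤ ∑ a ∈ Finset.Icc 1 m, √(c - ((a : ℝ) - (y + t * (q - x))) ^ 2) :=
      Finset.sum_nonneg fun _ _ => Real.sqrt_nonneg _
    have h5 : 0 ≤ π * c / 2 := by positivity
    gcongr
    rw [abs_le]
    constructor <;> linarith
  refine (Finset.sum_le_card_nsmul _ _ _ h1).trans ?_
  rw [nsmul_eq_mul, Int.card_Icc]
  have h6 : (((n + 1 - 1).toNat : ℕ) : ℝ) ≤ Q := by
    have : ((n + 1 - 1).toNat : ℤ) ≤ Q := by omega
    exact_mod_cast this
  calc _ ≤ (Q : ℝ) * (Q * Q * B) := by gcongr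
    _ = _ := by ring

theorem card_Icc_filter_lt_le {M : ℝ} (hM : 0 ≤ M) (n : ℤ) :
    (((Finset.Icc 1 n).filter fun q : ℤ => (q : ℝ) < M).card : ℝ) ≤ M := by
  have h : (Finset.Icc 1 n).filter (fun q : ℤ => (q : ℝ) < M) ⊆ Finset.Icc 1 ⌊M⌋ := by
    intro q hq
    rw [Finset.mem_filter, Finset.mem_Icc] at hq
    rw [Finset.mem_Icc]
    exact ⟨hq.1.1, Int.le_floor.2 hq.2.le⟩
  have h1 := Finset.card_le_card h
  rw [Int.card_Icc] at h1
  have h2 : (((⌊M⌋ + 1 - 1).toNat : ℕ) : ℝ) ≤ M := by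
    have h3 : ((⌊M⌋ + 1 - 1).toNat : ℤ) = ⌊M⌋ := by
      have := Int.floor_nonneg.2 hM
      omega
    have h4 := Int.floor_le M
    rw [← h3] at h4
    exact_mod_cast h4
  exact le_trans (by exact_mod_cast h1) h2

theorem abs_stripDeviation_sub_le {x y c t H B M : ℝ} {d n m Q : ℤ} (hc : 0 ≤ c)
    (hH : (2 * √c + 3) * √(2 * √c) ≤ H) (hB : π * c / 2 + H ≤ B) (hd : 0 ≤ d) (hn : 0 ≤ n)
    (hQ : n + d ≤ Q) (hM0 : 0 ≤ M)
    (hM : ∀ q ∈ Finset.Icc 1 n, M ≤ (q : ℝ) → ∀ a ∉ Finset.Icc 1 m,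
      √c ≤ |(a : ℝ) - (y + t * (q - x))|) :
    |stripDeviation x y c t d n m - ∑ q ∈ Finset.Icc 1 n, (q : ℝ) * (q + d) *
      (periodizedProfile c (y - t * x + q * t) - π * c / 2)| ≤ M * (Q * Q * B) := by
  have hH0 : 0 ≤ H := le_trans (by positivity) hH
  have hB0 : 0 ≤ B := le_trans (by positivity) hB
  have hQ0 : (0:ℝ) ≤ Q := by exact_mod_cast (by omega : 0 ≤ Q)
  unfold stripDeviation
  rw [← Finset.sum_sub_distrib]
  refine (Finset.abs_sum_le_sum_abs _ _).trans ?_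
  have h1 : ∀ q ∈ Finset.Icc 1 n, |(q : ℝ) * (q + d) *
      (∑ a ∈ Finset.Icc 1 m, √(c - ((a : ℝ) - (y + t * (q - x))) ^ 2) - π * c / 2)
      - (q : ℝ) * (q + d) * (periodizedProfile c (y - t * x + q * t) - π * c / 2)|
      ≤ if (q : ℝ) < M then Q * Q * B else 0 := by
    intro q hq
    rw [show y - t * x + q * t = y + t * (q - x) by ring, ← mul_sub, sub_sub_sub_cancel_right]
    split_ifs with hqM
    · rw [Finset.mem_Icc] at hq
      have hq0 : (0:ℝ) ≤ q := by exact_mod_cast (by omega : 0 ≤ q)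
      have hd0 : (0:ℝ) ≤ d := by exact_mod_cast hd
      have hqQ : (q:ℝ) ≤ Q := by exact_mod_cast (by omega : q ≤ Q)
      have hqdQ : (q:ℝ) + d ≤ Q := by exact_mod_cast (by omega : q + d ≤ Q)
      rw [abs_mul, abs_of_nonneg (by positivity)]
      have h2 := sum_le_periodizedProfile c (y + t * (q - x)) (Finset.Icc 1 m)
      have h3 := periodizedProfile_le hc hH (y + t * (q - x))
      have h4 : 0 ≤ ∑ a ∈ Finset.Icc 1 m, √(c - ((a : ℝ) - (y + t * (q - x))) ^ 2) :=
        Finset.sum_nonneg fun _ _ => Real.sqrt_nonneg _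
      gcongr
      rw [abs_le]
      constructor <;> linarith
    · rw [periodizedProfile_eq_sum (hM q hq (not_lt.1 hqM))]
      simp
  refine (Finset.sum_le_sum h1).trans ?_
  rw [← Finset.sum_filter, Finset.sum_const, nsmul_eq_mul]
  gcongr
  exact card_Icc_filter_lt_le hM0 n

/-- The fraction `b / d` stays at distance more than `1 / (k N ^ 5)` from every fraction of `[0, 1]`
with denominator `k < N ^ 2`. -/
def FarFromSmallFractions (N : ℕ) (d b : ℤ) : Prop :=
  ∀ k h : ℕ, 1 ≤ k → k < N ^ 2 → h ≤ k → (d : ℝ) / N ^ 5 < |(b : ℝ) * k - h * d|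

theorem FarFromSmallFractions.le_den {N : ℕ} (hN : 2 ≤ N) {d b : ℤ} (hb : 1 ≤ b) (hbd : b ≤ d)
    (hfar : FarFromSmallFractions N d b) {p : ℚ}
    (hp : |(b : ℝ) / (d : ℝ) - p| ≤ 1 / (((N ^ 5 : ℕ) + 1) * p.den)) : N ^ 2 ≤ p.den := by
  by_contra! hlt
  have hd0 : (0:ℝ) < d := by exact_mod_cast (by omega : 0 < d)
  have hb0 : (0:ℝ) < b := by exact_mod_cast hb
  have hbd' : (b:ℝ) ≤ d := by exact_mod_cast hbd
  have hden : (0:ℝ) < p.den := by exact_mod_cast p.den_pos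
  have hNpos : (0:ℝ) < N := by positivity
  have hpc : (p : ℝ) = (p.num : ℝ) / p.den := by exact_mod_cast (Rat.num_div_den p).symm
  have h1 : |(b : ℝ) * p.den - p.num * d| ≤ d / (N ^ 5 + 1) := by
    have h2 : (b : ℝ) * p.den - p.num * d = d * p.den * ((b : ℝ) / (d : ℝ) - p) := by
      rw [hpc]
      field_simp
    rw [h2, abs_mul, abs_of_pos (by positivity)]
    calc _ ≤ (d : ℝ) * p.den * (1 / (((N ^ 5 : ℕ) + 1) * p.den)) := by gcongr
      _ = _ := by rw [mul_one_div, mul_div_mul_right _ _ hden.ne', Nat.cast_pow]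
  have h3 : (d : ℝ) / (N ^ 5 + 1) < d / N ^ 5 := by
    apply div_lt_div_of_pos_left hd0 (by positivity)
    linarith
  have h4 : (d : ℝ) / (N ^ 5 + 1) < d := by
    apply div_lt_self hd0
    have : (0:ℝ) < (N:ℝ) ^ 5 := by positivity
    linarith
  have h5 := abs_le.1 h1
  have h6 : 0 ≤ p.num := by
    by_contra! hneg
    have : (p.num : ℝ) ≤ -1 := by exact_mod_cast (by omega : p.num ≤ -1)
    have : (p.num : ℝ) * d ≤ -d := by nlinarith
    have : 0 < (b : ℝ) * p.den := by positivity
    linarith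
  have h7 : p.num ≤ p.den := by
    by_contra! hgt
    have : (p.den : ℝ) + 1 ≤ p.num := by exact_mod_cast hgt
    have : ((p.den : ℝ) + 1) * d ≤ (p.num : ℝ) * d := by gcongr
    have : (b : ℝ) * p.den ≤ d * p.den := by gcongr
    nlinarith
  have h8 := hfar p.den p.num.toNat p.den_pos hlt (by omega)
  have h9 : ((p.num.toNat : ℕ) : ℝ) = p.num := by
    have : ((p.num.toNat : ℕ) : ℤ) = p.num := Int.toNat_of_nonneg h6
    exact_mod_cast congrArg (Int.cast : ℤ → ℝ) this
  rw [h9] at h8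
  linarith

theorem abs_stripDeviation_le_of_far {x y r H B : ℝ} (hx0 : x ∈ Set.Ico (0 : ℝ) 1)
    (hy0 : y ∈ Set.Ico (0 : ℝ) 1) (hr : 0 < r) {N : ℕ} (hN : 2 ≤ N) (hrN : 1 + 2 * r ≤ N)
    {Q d b : ℤ} (hQ : (N : ℤ) ^ 10 ≤ Q) (hb : 1 ≤ b) (hbd : b ≤ d) (hdQ : d ≤ Q)
    (hfar : FarFromSmallFractions N d b) {c : ℝ} (hc : 0 ≤ c) (hcr : √c ≤ 2 * r)
    (hH : (2 * √c + 3) * √(2 * √c) ≤ H) (hB : π * c / 2 + H ≤ B) :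
    |stripDeviation x y c ((b : ℝ) / (d : ℝ)) d (Q - d) (Q - b)|
      ≤ (12 * H + (2 * r + 2) * B) * ((Q : ℝ) ^ 3 / N) := by
  have hH0 : 0 ≤ H := le_trans (by positivity) hH
  have hB0 : 0 ≤ B := le_trans (by positivity) hB
  have hd0 : (0:ℝ) < d := by exact_mod_cast (by omega : 0 < d)
  have hb0 : (0:ℝ) < b := by exact_mod_cast hb
  have hbd' : (b:ℝ) ≤ d := by exact_mod_cast hbd
  have hdQ' : (d:ℝ) ≤ Q := by exact_mod_cast hdQ
  have hd1 : (1:ℝ) ≤ d := by exact_mod_cast (by omega : 1 ≤ d)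
  have hN2 : (2:ℝ) ≤ N := by exact_mod_cast hN
  have hN0 : (0:ℝ) < N := by linarith
  have hQN : (N:ℝ) ^ 10 ≤ Q := by exact_mod_cast hQ
  have hQ0 : (0:ℝ) < Q := lt_of_lt_of_le (by positivity) hQN
  have hN1 : (1:ℝ) ≤ N := by linarith
  have hNQ : (N:ℝ) ^ 5 ≤ Q / N := by
    rw [le_div_iff₀ hN0]
    calc (N:ℝ) ^ 5 * N = (N:ℝ) ^ 6 := by ring
      _ ≤ (N:ℝ) ^ 10 := pow_le_pow_right₀ hN1 (by norm_num)
      _ ≤ Q := hQN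
  obtain ⟨p, hp, hpN⟩ := Real.exists_rat_abs_sub_le_and_den_le ((b : ℝ) / (d : ℝ))
    (n := N ^ 5) (by positivity)
  have hden := hfar.le_den hN hb hbd hp
  have hden' : (N:ℝ) ^ 2 ≤ p.den := by exact_mod_cast hden
  have hone : 1 < N ^ 2 := by nlinarith
  set t : ℝ := (b : ℝ) / (d : ℝ) with ht
  have htd : t * d = b := by rw [ht]; field_simp
  have ht0 : 1 / (N:ℝ) ^ 5 < t := by
    have := hfar 1 0 le_rfl hone (by norm_num)
    simp only [Nat.cast_one, mul_one, Nat.cast_zero, zero_mul, sub_zero, abs_of_pos hb0] at this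
    rw [ht, lt_div_iff₀ hd0]
    calc _ = (d : ℝ) / N ^ 5 := by ring
      _ < _ := this
  have ht1 : t + 1 / (N:ℝ) ^ 5 < 1 := by
    have := hfar 1 1 le_rfl hone le_rfl
    simp only [Nat.cast_one, mul_one, one_mul] at this
    rw [abs_of_nonpos (by linarith)] at this
    have h2 : (t + 1 / (N:ℝ) ^ 5) * d < 1 * d := by
      rw [add_mul, htd]
      calc _ = (b:ℝ) + (d : ℝ) / N ^ 5 := by ring
        _ < _ := by linarith
    exact lt_of_mul_lt_mul_right h2 hd0.le
  have htpos : 0 < t := lt_trans (by positivity) ht0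
  have hclose := abs_stripDeviation_sub_le (x := x) (y := y) (t := t) (d := d) (n := Q - d)
    (m := Q - b) (Q := Q) (M := (2 * r + 2) * N ^ 5) hc hH hB (by omega) (by omega) (by omega)
    (by positivity) (by
      intro q hq hqM a ha
      rw [Finset.mem_Icc] at hq
      have hqn : (q:ℝ) ≤ Q - d := by exact_mod_cast hq.2
      rw [Finset.mem_Icc, not_and_or, not_le, not_le] at ha
      obtain ⟨hx1, hx2⟩ := hx0
      obtain ⟨hy1, hy2⟩ := hy0
      refine hcr.trans ?_
      rw [le_abs]
      rcases ha with ha | ha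
      · right
        have ha' : (a:ℝ) ≤ 0 := by exact_mod_cast (by omega : a ≤ 0)
        have hN5 : (1:ℝ) ≤ (N:ℝ) ^ 5 := one_le_pow₀ hN1
        have h1 : (2 * r + 1) * (N:ℝ) ^ 5 ≤ q - x := by nlinarith
        have h2 : 2 * r + 1 ≤ t * (q - x) := by
          calc 2 * r + 1 = 1 / (N:ℝ) ^ 5 * ((2 * r + 1) * (N:ℝ) ^ 5) := by field_simp
            _ ≤ t * (q - x) := by gcongr
        linarith
      · left
        have ha' : (Q:ℝ) - b + 1 ≤ a := by exact_mod_cast (by omega : Q - b + 1 ≤ a)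
        have h1 : t * (q - x) ≤ t * (Q - d) := 
          mul_le_mul_of_nonneg_left (by linarith) htpos.le
        have h2 : t * (Q:ℝ) ≤ Q - N ^ 5 := by
          have h3 : (t + 1 / (N:ℝ) ^ 5) * Q ≤ 1 * Q := by gcongr
          have h4 : (N:ℝ) ^ 5 ≤ 1 / (N:ℝ) ^ 5 * Q := by
            rw [one_div, inv_mul_eq_div, le_div_iff₀ (by positivity)]
            calc _ = (N:ℝ) ^ 10 := by ring
              _ ≤ _ := hQN
          linarith
        have h5 : (N:ℝ) ≤ (N:ℝ) ^ 5 := le_self_pow₀ hN1 (by norm_num)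
        rw [mul_sub t (Q:ℝ) d, htd] at h1
        linarith)
  have hmain := abs_sum_mul_periodizedProfile_sub_le hc hH hp hpN (n := Q - d) (d := d)
    (by omega) (by omega) (y - t * x)
  have hs1 : √(1 / (((N ^ 5 : ℕ) : ℝ) + 1)) ≤ 1 / N := by
    apply Real.sqrt_le_iff.2 ⟨by positivity, ?_⟩
    rw [div_pow, one_pow]
    gcongr
    push_cast
    have : (N:ℝ) ^ 2 ≤ (N:ℝ) ^ 5 := pow_le_pow_right₀ hN1 (by norm_num)
    linarith
  have hs2 : √(1 / (p.den : ℝ)) ≤ 1 / N := by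
    apply Real.sqrt_le_iff.2 ⟨by positivity, ?_⟩
    rw [div_pow, one_pow]
    gcongr
  have hQd : (0:ℝ) ≤ ((Q - d : ℤ) : ℝ) := by exact_mod_cast (by omega : 0 ≤ Q - d)
  have hbound : 2 * ((((Q - d : ℤ) : ℝ) + 1) * (((Q - d : ℤ) : ℝ) + 1 + d)) *
      (((Q - d : ℤ) : ℝ) * (H * √(1 / (((N ^ 5 : ℕ) : ℝ) + 1)) + H * √(1 / (p.den : ℝ)))
        + ((N ^ 5 : ℕ) : ℝ) * H) ≤ 12 * H * ((Q : ℝ) ^ 3 / N) := by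
    have h1 : ((Q - d : ℤ) : ℝ) + 1 ≤ Q := by push_cast; linarith
    have h2 : ((Q - d : ℤ) : ℝ) + 1 + d ≤ 2 * Q := by push_cast; linarith
    have h3 : ((Q - d : ℤ) : ℝ) ≤ Q := by linarith
    calc _ ≤ 2 * ((Q:ℝ) * (2 * Q)) * (Q * (H * (1 / N) + H * (1 / N)) + Q / N * H) := by
          have : ((N ^ 5 : ℕ) : ℝ) ≤ Q / N := by push_cast; exact hNQ
          gcongr
      _ = _ := by ring
  have hbound2 : (2 * r + 2) * (N:ℝ) ^ 5 * (Q * Q * B) ≤ (2 * r + 2) * B * ((Q : ℝ) ^ 3 / N) := by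
    calc _ ≤ (2 * r + 2) * ((Q:ℝ) / N) * (Q * Q * B) := by gcongr
      _ = _ := by ring
  have h1 := abs_le.1 (hmain.trans hbound)
  have h2 := abs_le.1 (hclose.trans hbound2)
  rw [abs_le]
  constructor <;> linarith

open scoped Classical in
theorem card_not_farFromSmallFractions_le {N : ℕ} (hN : 1 ≤ N) {d : ℤ} (hd : 1 ≤ d) :
    (((Finset.Icc 1 d).filter fun b => ¬ FarFromSmallFractions N d b).card : ℝ)
      ≤ 2 * d / N + N ^ 4 := by
  have hd0 : (0:ℝ) < d := by exact_mod_cast hd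
  have hN0 : (0:ℝ) < N := by exact_mod_cast hN
  have hsub : ((Finset.Icc 1 d).filter fun b => ¬ FarFromSmallFractions N d b) ⊆
      (Finset.range (N ^ 2) ×ˢ Finset.range (N ^ 2)).biUnion fun kh =>
        Finset.Icc ⌈(kh.2 : ℝ) * d / kh.1 - d / N ^ 5⌉ ⌊(kh.2 : ℝ) * d / kh.1 + d / N ^ 5⌋ := by
    intro b hb
    rw [Finset.mem_filter] at hb
    obtain ⟨_, hb⟩ := hb
    unfold FarFromSmallFractions at hb
    push Not at hb
    obtain ⟨k, h, hk1, hk2, hhk, hle⟩ := hb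
    rw [Finset.mem_biUnion]
    refine ⟨(k, h), ?_, ?_⟩
    · simp only [Finset.mem_product, Finset.mem_range]
      omega
    · have hk0 : (1:ℝ) ≤ k := by exact_mod_cast hk1
      have h1 : |(b : ℝ) - h * d / k| ≤ d / N ^ 5 := by
        have h2 : (b : ℝ) - h * d / k = (b * k - h * d) / k := by field_simp
        rw [h2, abs_div, Nat.abs_cast]
        exact (div_le_self (abs_nonneg _) hk0).trans hle
      have h3 := abs_le.1 h1
      rw [Finset.mem_Icc, Int.ceil_le, Int.le_floor]
      constructor <;> simp only <;> linarith
  have h1 := (Finset.card_le_card hsub).trans Finset.card_biUnion_le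
  have h2 : ∀ kh ∈ Finset.range (N ^ 2) ×ˢ Finset.range (N ^ 2),
      ((Finset.Icc ⌈(kh.2 : ℝ) * d / kh.1 - d / N ^ 5⌉
        ⌊(kh.2 : ℝ) * d / kh.1 + d / N ^ 5⌋).card : ℝ) ≤ 2 * d / N ^ 5 + 1 := by
    intro kh _
    rw [Int.card_Icc]
    set u := (kh.2 : ℝ) * d / kh.1
    have h3 : ((⌊u + d / N ^ 5⌋ + 1 - ⌈u - d / N ^ 5⌉ : ℤ) : ℝ) ≤ 2 * d / N ^ 5 + 1 := by
      push_cast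
      have := Int.floor_le (u + d / (N:ℝ) ^ 5)
      have := Int.le_ceil (u - d / (N:ℝ) ^ 5)
      rw [mul_div_assoc]
      linarith
    have h4 : (((⌊u + d / N ^ 5⌋ + 1 - ⌈u - d / N ^ 5⌉).toNat : ℤ) : ℝ)
        ≤ 2 * d / N ^ 5 + 1 := by
      rw [Int.toNat_eq_max]
      push_cast at h3 ⊢
      exact max_le h3 (by positivity)
    exact_mod_cast h4
  have h5 := Finset.sum_le_card_nsmul _ _ _ h2
  rw [nsmul_eq_mul, Finset.card_product, Finset.card_range] at h5
  calc _ ≤ ((∑ kh ∈ Finset.range (N ^ 2) ×ˢ Finset.range (N ^ 2),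
        (Finset.Icc ⌈(kh.2 : ℝ) * d / kh.1 - d / N ^ 5⌉
        ⌊(kh.2 : ℝ) * d / kh.1 + d / N ^ 5⌋).card : ℕ) : ℝ) := by exact_mod_cast h1
    _ ≤ ((N ^ 2 * N ^ 2 : ℕ) : ℝ) * (2 * d / N ^ 5 + 1) := by push_cast at h5 ⊢; exact h5
    _ = _ := by
      push_cast
      field_simp

theorem SQ_eq_main_add_stripDeviation (x y r : ℝ) (hr : 0 < r) (Q : ℕ) :
    SQ x y r Q = 2 / (Q : ℝ) ^ 4 *
      (π * r ^ 2 / 2 * (4 / 3 * (((Q : ℝ) - 1) * Q * (Q + 1) * (3 * Q + 2) / 24) +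
        ∑ d ∈ Finset.Icc (1 : ℤ) Q, (1 / (2 * d) + 1 / (6 * (d : ℝ) ^ 2)) *
          ∑ q ∈ Finset.Icc 1 ((Q : ℤ) - d), (q : ℝ) * (q + d)) +
      ∑ d ∈ Finset.Icc (1 : ℤ) Q, 1 / (d : ℝ) * ∑ b ∈ Finset.Icc 1 d,
        stripDeviation x y (r ^ 2 * (1 + ((b : ℝ) / (d : ℝ)) ^ 2)) ((b : ℝ) / (d : ℝ)) d
          (Q - d) (Q - b)) := by
  rw [SQ_eq x y r hr, ← sum_sum_Icc_mul_add]
  congr 1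
  rw [Finset.mul_sum _ _ (4 / 3 : ℝ), ← Finset.sum_add_distrib,
    Finset.mul_sum _ _ (π * r ^ 2 / 2), ← Finset.sum_add_distrib]
  apply Finset.sum_congr rfl
  intro d hd
  rw [Finset.mem_Icc] at hd
  have hd0 : (d : ℝ) ≠ 0 := by
    have : (0:ℝ) < d := by exact_mod_cast (by omega : 0 < d)
    exact this.ne'
  have h1 : ∀ b ∈ Finset.Icc 1 d, ∑ q ∈ Finset.Icc 1 ((Q : ℤ) - d),
      ∑ a ∈ Finset.Icc 1 ((Q : ℤ) - b),
        (q : ℝ) * (q + d) * (1 / d * √(r ^ 2 * (1 + ((b : ℝ) / (d : ℝ)) ^ 2)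
          - ((a : ℝ) - (y + (b : ℝ) / (d : ℝ) * (q - x))) ^ 2))
      = (1 + ((b : ℝ) / (d : ℝ)) ^ 2) * (1 / d * (π * r ^ 2 / 2) *
          ∑ q ∈ Finset.Icc 1 ((Q : ℤ) - d), (q : ℝ) * (q + d))
        + 1 / d * stripDeviation x y (r ^ 2 * (1 + ((b : ℝ) / (d : ℝ)) ^ 2))
          ((b : ℝ) / (d : ℝ)) d (Q - d) (Q - b) := by
    intro b _
    unfold stripDeviation
    rw [Finset.mul_sum, Finset.mul_sum, Finset.mul_sum, ← Finset.sum_add_distrib]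
    apply Finset.sum_congr rfl
    intro q _
    rw [← Finset.mul_sum, ← Finset.mul_sum]
    ring
  rw [Finset.sum_congr rfl h1, Finset.sum_add_distrib, ← Finset.sum_mul,
    sum_Icc_one_add_div_sq hd.1, ← Finset.mul_sum]
  congr 1
  field_simp
  ring

theorem sum_Icc_mul_add_le {Q d : ℤ} (hd : 0 ≤ d) (hdQ : d ≤ Q) :
    ∑ q ∈ Finset.Icc 1 (Q - d), (q : ℝ) * (q + d) ≤ (Q : ℝ) ^ 3 := by
  have hQ0 : (0:ℝ) ≤ Q := by exact_mod_cast (by omega : 0 ≤ Q)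
  have h1 : ∀ q ∈ Finset.Icc 1 (Q - d), (q : ℝ) * (q + d) ≤ Q * Q := by
    intro q hq
    rw [Finset.mem_Icc] at hq
    have hq0 : (0:ℝ) ≤ q := by exact_mod_cast (by omega : 0 ≤ q)
    have hd0 : (0:ℝ) ≤ d := by exact_mod_cast hd
    have hqQ : (q:ℝ) ≤ Q := by exact_mod_cast (by omega : q ≤ Q)
    have hqdQ : (q:ℝ) + d ≤ Q := by exact_mod_cast (by omega : q + d ≤ Q)
    gcongr
  refine (Finset.sum_le_card_nsmul _ _ _ h1).trans ?_
  rw [nsmul_eq_mul, Int.card_Icc]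
  have h6 : (((Q - d + 1 - 1).toNat : ℕ) : ℝ) ≤ Q := by
    have : ((Q - d + 1 - 1).toNat : ℤ) ≤ Q := by omega
    exact_mod_cast this
  calc _ ≤ (Q : ℝ) * (Q * Q) := by gcongr
    _ = _ := by ring

theorem exists_abs_SQ_sub_le {x y r : ℝ} (hx : x ∈ Set.Ico (0 : ℝ) 1)
    (hy : y ∈ Set.Ico (0 : ℝ) 1) (hr : 0 < r) :
    ∃ C : ℝ, ∀ N Q : ℕ, 2 ≤ N → 1 + 2 * r ≤ N → N ^ 10 ≤ Q →
      |SQ x y r Q - π * r ^ 2 / 6| ≤ C / N := by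
  obtain ⟨H, hHdef⟩ : ∃ H, H = (4 * r + 3) * √(4 * r) := ⟨_, rfl⟩
  obtain ⟨B, hBdef⟩ : ∃ B, B = π * r ^ 2 + H := ⟨_, rfl⟩
  obtain ⟨A, hAdef⟩ : ∃ A, A = 12 * H + (2 * r + 2) * B := ⟨_, rfl⟩
  have hH0 : 0 ≤ H := by rw [hHdef]; positivity
  have hB0 : 0 ≤ B := by rw [hBdef]; positivity
  have hA0 : 0 ≤ A := by rw [hAdef]; positivity
  refine ⟨2 * (2 * π * r ^ 2 + A + 4 * B), fun N Q hN hrN hQ => ?_⟩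
  have hN2 : (2:ℝ) ≤ N := by exact_mod_cast hN
  have hN1 : (1:ℝ) ≤ N := by linarith
  have hN0 : (0:ℝ) < N := by linarith
  have hQN : (N:ℝ) ^ 10 ≤ Q := by exact_mod_cast hQ
  have hQ0 : (0:ℝ) < Q := lt_of_lt_of_le (by positivity) hQN
  have hNQ : (N:ℝ) ≤ Q := (le_self_pow₀ hN1 (by norm_num)).trans hQN
  have hsqrt : (N:ℝ) ^ 5 ≤ √Q := by
    apply Real.le_sqrt_of_sq_le
    rw [← pow_mul]
    exact hQN
  have hQsq : √(Q:ℝ) * √Q = Q := Real.mul_self_sqrt hQ0.le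
  have hNsqrt : (N:ℝ) ^ 4 * √Q ≤ Q / N := by
    rw [le_div_iff₀ hN0]
    calc (N:ℝ) ^ 4 * √Q * N = N ^ 5 * √Q := by ring
      _ ≤ √Q * √Q := by gcongr
      _ = Q := hQsq
  have hsqrtN : √(Q:ℝ) ≤ Q / N := by
    refine le_trans ?_ hNsqrt
    exact le_mul_of_one_le_left (Real.sqrt_nonneg _) (one_le_pow₀ hN1)
  have hharm := sum_Icc_one_div_le Q
  have hdev : ∀ d ∈ Finset.Icc (1 : ℤ) Q, |∑ b ∈ Finset.Icc 1 d,
        stripDeviation x y (r ^ 2 * (1 + ((b : ℝ) / (d : ℝ)) ^ 2)) ((b : ℝ) / (d : ℝ)) d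
          (Q - d) (Q - b)| ≤ d * (A * ((Q : ℝ) ^ 3 / N)) + (2 * d / N + N ^ 4) * (B * Q ^ 3) := by
    classical
    intro d hd
    rw [Finset.mem_Icc] at hd
    have hd0 : (0:ℝ) < d := by exact_mod_cast (by omega : 0 < d)
    refine (Finset.abs_sum_le_sum_abs _ _).trans ?_
    have h1 : ∀ b ∈ Finset.Icc 1 d,
        |stripDeviation x y (r ^ 2 * (1 + ((b : ℝ) / (d : ℝ)) ^ 2)) ((b : ℝ) / (d : ℝ)) d
          (Q - d) (Q - b)| ≤ A * ((Q : ℝ) ^ 3 / N)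
            + if ¬ FarFromSmallFractions N d b then B * (Q : ℝ) ^ 3 else 0 := by
      intro b hb
      rw [Finset.mem_Icc] at hb
      have hb0 : (0:ℝ) < b := by exact_mod_cast (by omega : 0 < b)
      have hbd : (b:ℝ) ≤ d := by exact_mod_cast hb.2
      have ht1 : ((b : ℝ) / (d : ℝ)) ^ 2 ≤ 1 := by
        apply pow_le_one₀ (by positivity)
        rw [div_le_one hd0]
        exact hbd
      have hc : 0 ≤ r ^ 2 * (1 + ((b : ℝ) / (d : ℝ)) ^ 2) := by positivity
      have hc2 : r ^ 2 * (1 + ((b : ℝ) / (d : ℝ)) ^ 2) ≤ 2 * r ^ 2 := by nlinarith [sq_nonneg r]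
      have hcr : √(r ^ 2 * (1 + ((b : ℝ) / (d : ℝ)) ^ 2)) ≤ 2 * r := by
        apply Real.sqrt_le_iff.2 ⟨by positivity, ?_⟩
        nlinarith [sq_nonneg r]
      have hH : (2 * √(r ^ 2 * (1 + ((b : ℝ) / (d : ℝ)) ^ 2)) + 3) *
          √(2 * √(r ^ 2 * (1 + ((b : ℝ) / (d : ℝ)) ^ 2))) ≤ H := by
        have h2 : 2 * √(r ^ 2 * (1 + ((b : ℝ) / (d : ℝ)) ^ 2)) ≤ 4 * r := by linarith
        rw [hHdef]
        exact mul_le_mul (by linarith) (Real.sqrt_le_sqrt h2) (by positivity) (by positivity)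
      have hB : π * (r ^ 2 * (1 + ((b : ℝ) / (d : ℝ)) ^ 2)) / 2 + H ≤ B := by
        rw [hBdef]
        have := mul_le_mul_of_nonneg_left hc2 Real.pi_nonneg
        linarith
      split_ifs with hfar
      · have := abs_stripDeviation_le_of_far hx hy hr hN hrN (Q := Q) (d := d) (b := b)
          (by exact_mod_cast hQ) hb.1 hb.2 hd.2 hfar hc hcr hH hB
        rw [← hAdef] at this
        push_cast at this
        linarith
      · have := abs_stripDeviation_le (x := x) (y := y) (t := (b : ℝ) / (d : ℝ)) (d := d)
          (n := Q - d) (m := Q - b) (Q := Q) hc hH hB (by omega) (by omega) (by omega)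
        have h2 : 0 ≤ A * ((Q : ℝ) ^ 3 / N) := by positivity
        push_cast at this
        linarith
    refine (Finset.sum_le_sum h1).trans ?_
    rw [Finset.sum_add_distrib, Finset.sum_const, ← Finset.sum_filter, Finset.sum_const,
      nsmul_eq_mul, nsmul_eq_mul]
    have h3 := card_not_farFromSmallFractions_le (N := N) (by omega) hd.1
    have h4 : (((Finset.Icc 1 d).card : ℕ) : ℝ) = d := by
      have : (((Finset.Icc 1 d).card : ℕ) : ℤ) = d := by
        rw [Int.card_Icc]
        omega
      exact_mod_cast congrArg (Int.cast : ℤ → ℝ) this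
    rw [h4]
    gcongr
  have hE : |∑ d ∈ Finset.Icc (1 : ℤ) Q, 1 / (d : ℝ) * ∑ b ∈ Finset.Icc 1 d,
        stripDeviation x y (r ^ 2 * (1 + ((b : ℝ) / (d : ℝ)) ^ 2)) ((b : ℝ) / (d : ℝ)) d
          (Q - d) (Q - b)| ≤ (A + 4 * B) * ((Q:ℝ) ^ 4 / N) := by
    refine (Finset.abs_sum_le_sum_abs _ _).trans ?_
    have h1 : ∀ d ∈ Finset.Icc (1 : ℤ) Q, |1 / (d : ℝ) * ∑ b ∈ Finset.Icc 1 d,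
        stripDeviation x y (r ^ 2 * (1 + ((b : ℝ) / (d : ℝ)) ^ 2)) ((b : ℝ) / (d : ℝ)) d
          (Q - d) (Q - b)| ≤ (A + 2 * B) * ((Q : ℝ) ^ 3 / N) +
            N ^ 4 * (B * Q ^ 3) * (1 / (d : ℝ)) := by
      intro d hd
      have h2 := hdev d hd
      rw [Finset.mem_Icc] at hd
      have hd0 : (0:ℝ) < d := by exact_mod_cast (by omega : 0 < d)
      rw [abs_mul, abs_of_pos (by positivity)]
      calc _ ≤ 1 / (d : ℝ) *
            (d * (A * ((Q : ℝ) ^ 3 / N)) + (2 * d / N + N ^ 4) * (B * Q ^ 3)) := by gcongr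
        _ = _ := by field_simp; ring
    refine (Finset.sum_le_sum h1).trans ?_
    rw [Finset.sum_add_distrib, Finset.sum_const, ← Finset.mul_sum, nsmul_eq_mul, Int.card_Icc]
    have h3 : ((((Q : ℤ) + 1 - 1).toNat : ℕ) : ℝ) = Q := by simp
    rw [h3]
    calc _ ≤ (Q:ℝ) * ((A + 2 * B) * ((Q : ℝ) ^ 3 / N)) + N ^ 4 * (B * Q ^ 3) * (2 * √Q) := by
          gcongr
      _ = (Q:ℝ) * ((A + 2 * B) * ((Q : ℝ) ^ 3 / N)) + 2 * B * Q ^ 3 * (N ^ 4 * √Q) := by ring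
      _ ≤ (Q:ℝ) * ((A + 2 * B) * ((Q : ℝ) ^ 3 / N)) + 2 * B * Q ^ 3 * (Q / N) := by gcongr
      _ = _ := by ring
  have hZ0 : ∀ d ∈ Finset.Icc (1 : ℤ) Q,
      0 ≤ ∑ q ∈ Finset.Icc 1 ((Q : ℤ) - d), (q : ℝ) * (q + d) := by
    intro d hd
    rw [Finset.mem_Icc] at hd
    apply Finset.sum_nonneg
    intro q hq
    rw [Finset.mem_Icc] at hq
    have hq0 : (0:ℝ) ≤ q := by exact_mod_cast (by omega : 0 ≤ q)
    have hd0 : (0:ℝ) ≤ d := by exact_mod_cast (by omega : 0 ≤ d)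
    positivity
  have hR : |∑ d ∈ Finset.Icc (1 : ℤ) Q, (1 / (2 * d) + 1 / (6 * (d : ℝ) ^ 2)) *
      ∑ q ∈ Finset.Icc 1 ((Q : ℤ) - d), (q : ℝ) * (q + d)| ≤ 2 * ((Q:ℝ) ^ 4 / N) := by
    refine (Finset.abs_sum_le_sum_abs _ _).trans ?_
    have h1 : ∀ d ∈ Finset.Icc (1 : ℤ) Q, |(1 / (2 * d) + 1 / (6 * (d : ℝ) ^ 2)) *
        ∑ q ∈ Finset.Icc 1 ((Q : ℤ) - d), (q : ℝ) * (q + d)| ≤ (Q:ℝ) ^ 3 * (1 / (d : ℝ)) := by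
      intro d hd
      have h0 := hZ0 d hd
      rw [Finset.mem_Icc] at hd
      have h2 := sum_Icc_mul_add_le (Q := Q) (d := d) (by omega) hd.2
      have hd1 : (1:ℝ) ≤ d := by exact_mod_cast hd.1
      rw [abs_of_nonneg (by positivity), mul_comm]
      have h3 : 1 / (2 * (d:ℝ)) + 1 / (6 * (d : ℝ) ^ 2) ≤ 1 / d := by
        have : 1 / (6 * (d : ℝ) ^ 2) ≤ 1 / (2 * (d:ℝ)) := by
          apply one_div_le_one_div_of_le (by positivity)
          nlinarith
        calc _ ≤ 1 / (2 * (d:ℝ)) + 1 / (2 * (d:ℝ)) := by gcongr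
          _ = _ := by field_simp; norm_num
      push_cast at h2
      gcongr
    refine (Finset.sum_le_sum h1).trans ?_
    rw [← Finset.mul_sum]
    calc _ ≤ (Q:ℝ) ^ 3 * (2 * (Q / N)) := by
          gcongr
          exact hharm.trans (by linarith)
      _ = _ := by ring
  have hP : |((Q : ℝ) - 1) * Q * (Q + 1) * (3 * Q + 2) / 24 - (Q:ℝ) ^ 4 / 8|
      ≤ (Q:ℝ) ^ 4 / N := by
    have h1 : (1:ℝ) ≤ Q := hN1.trans hNQ
    have h2 : (Q:ℝ) ^ 3 ≤ (Q:ℝ) ^ 4 / N := by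
      rw [le_div_iff₀ hN0]
      calc (Q:ℝ) ^ 3 * N ≤ (Q:ℝ) ^ 3 * Q := by gcongr
        _ = _ := by ring
    refine le_trans ?_ h2
    have h3 : (Q:ℝ) ≤ Q ^ 3 := le_self_pow₀ h1 (by norm_num)
    have h4 : (Q:ℝ) ^ 2 ≤ Q ^ 3 := pow_le_pow_right₀ h1 (by norm_num)
    rw [show ((Q : ℝ) - 1) * Q * (Q + 1) * (3 * Q + 2) / 24 - (Q:ℝ) ^ 4 / 8
      = (Q:ℝ) ^ 3 / 12 - Q ^ 2 / 8 - Q / 12 by ring]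
    have h5 : (0:ℝ) ≤ Q ^ 2 := by positivity
    rw [abs_le]
    constructor <;> linarith
  rw [SQ_eq_main_add_stripDeviation x y r hr]
  generalize (∑ d ∈ Finset.Icc (1 : ℤ) Q, 1 / (d : ℝ) * ∑ b ∈ Finset.Icc 1 d,
        stripDeviation x y (r ^ 2 * (1 + ((b : ℝ) / (d : ℝ)) ^ 2)) ((b : ℝ) / (d : ℝ)) d
          (Q - d) (Q - b)) = E at hE ⊢
  generalize (∑ d ∈ Finset.Icc (1 : ℤ) Q, (1 / (2 * d) + 1 / (6 * (d : ℝ) ^ 2)) *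
      ∑ q ∈ Finset.Icc 1 ((Q : ℤ) - d), (q : ℝ) * (q + d)) = R at hR ⊢
  generalize ((Q : ℝ) - 1) * Q * (Q + 1) * (3 * Q + 2) / 24 = P at hP ⊢
  have hsplit : 2 / (Q : ℝ) ^ 4 * (π * r ^ 2 / 2 * (4 / 3 * P + R) + E) - π * r ^ 2 / 6
      = 2 / (Q : ℝ) ^ 4 * (π * r ^ 2 / 2 * (4 / 3 * (P - (Q:ℝ) ^ 4 / 8) + R) + E) := by
    field_simp
    ring
  rw [hsplit, abs_mul, abs_of_pos (by positivity)]
  have hX : 0 ≤ (Q:ℝ) ^ 4 / N := by positivity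
  have h1 : |4 / 3 * (P - (Q:ℝ) ^ 4 / 8) + R| ≤ 4 * ((Q:ℝ) ^ 4 / N) := by
    have h2 := abs_le.1 hP
    have h3 := abs_le.1 hR
    rw [abs_le]
    constructor <;> linarith
  have h4 : |π * r ^ 2 / 2 * (4 / 3 * (P - (Q:ℝ) ^ 4 / 8) + R) + E|
      ≤ π * r ^ 2 / 2 * (4 * ((Q:ℝ) ^ 4 / N)) + (A + 4 * B) * ((Q:ℝ) ^ 4 / N) := by
    refine (abs_add_le _ _).trans (add_le_add ?_ hE)
    rw [abs_mul, abs_of_nonneg (by positivity)]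
    gcongr
  calc _ ≤ 2 / (Q : ℝ) ^ 4 *
        (π * r ^ 2 / 2 * (4 * ((Q:ℝ) ^ 4 / N)) + (A + 4 * B) * ((Q:ℝ) ^ 4 / N)) := by gcongr
    _ = _ := by field_simp; ring

/-- Proposition 3.1: `S_Q = πr₀²/6 + O_{𝔻₀,δ}(Q^{-1/10+δ})`. -/
theorem SQ_asymptotic (x0 y0 r0 : ℝ)
    (hx0 : x0 ∈ Set.Ico (0 : ℝ) 1) (hy0 : y0 ∈ Set.Ico (0 : ℝ) 1) (hr0 : 0 < r0)
    (δ : ℝ) (hδ : 0 < δ) :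
    ∃ C : ℝ, ∀ Q : ℕ, 2 ≤ Q →
      |SQ x0 y0 r0 Q - π * r0 ^ 2 / 6| ≤ C * (Q : ℝ) ^ (-(1 / 10 : ℝ) + δ) := by
  obtain ⟨C, hC⟩ := exists_abs_SQ_sub_le hx0 hy0 hr0
  have hO : (fun Q : ℕ => SQ x0 y0 r0 Q - π * r0 ^ 2 / 6) =O[Filter.atTop]
      fun Q : ℕ => (Q : ℝ) ^ (-(1 / 10 : ℝ) + δ) := by
    obtain ⟨m, hm⟩ := exists_nat_ge (1 + 2 * r0)
    apply Asymptotics.IsBigO.of_bound (2 * |C|)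
    filter_upwards [Filter.eventually_ge_atTop ((m + 2) ^ 10)] with Q hQ
    have hQ1 : (1:ℝ) ≤ Q := by
      have : 1 ≤ (m + 2) ^ 10 := Nat.one_le_pow _ _ (by omega)
      exact_mod_cast this.trans hQ
    have hQ0 : (0:ℝ) < Q := by linarith
    have hroot : ((Q : ℝ) ^ (1 / 10 : ℝ)) ^ 10 = Q := by
      rw [← Real.rpow_natCast, ← Real.rpow_mul hQ0.le]
      norm_num
    have hroot0 : 0 ≤ (Q : ℝ) ^ (1 / 10 : ℝ) := by positivity
    set N := ⌊(Q : ℝ) ^ (1 / 10 : ℝ)⌋₊ with hNdef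
    have hmN : m + 2 ≤ N := by
      apply Nat.le_floor
      refine le_of_pow_le_pow_left₀ (n := 10) (by norm_num) hroot0 ?_
      rw [hroot]
      exact_mod_cast hQ
    have hmN' : (m : ℝ) + 2 ≤ N := by exact_mod_cast hmN
    have hNQ : N ^ 10 ≤ Q := by
      have : (N : ℝ) ^ 10 ≤ Q := by
        rw [← hroot]
        gcongr
        exact Nat.floor_le hroot0
      exact_mod_cast this
    have hm0 : (0:ℝ) ≤ m := by positivity
    have h1 := hC N Q (by omega) (by linarith) hNQ
    have h2 : (Q : ℝ) ^ (1 / 10 : ℝ) ≤ 2 * N := by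
      have := (Nat.lt_floor_add_one ((Q : ℝ) ^ (1 / 10 : ℝ))).le
      rw [← hNdef] at this
      linarith
    have hN0 : (0:ℝ) < N := by linarith
    have h3 : 1 / (N : ℝ) ≤ 2 * (Q : ℝ) ^ (-(1 / 10 : ℝ)) := by
      rw [Real.rpow_neg hQ0.le, ← div_eq_mul_inv, div_le_div_iff₀ hN0 (by positivity)]
      linarith
    have h4 : (Q : ℝ) ^ (-(1 / 10 : ℝ)) ≤ (Q : ℝ) ^ (-(1 / 10 : ℝ) + δ) :=
      Real.rpow_le_rpow_of_exponent_le hQ1 (by linarith)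
    rw [Real.norm_eq_abs, Real.norm_eq_abs,
      abs_of_nonneg (by positivity : (0 : ℝ) ≤ (Q : ℝ) ^ (-(1 / 10 : ℝ) + δ))]
    calc _ ≤ C / N := h1
      _ ≤ |C| * (1 / N) := by rw [mul_one_div]; gcongr; exact le_abs_self C
      _ ≤ |C| * (2 * (Q : ℝ) ^ (-(1 / 10 : ℝ) + δ)) := by gcongr; linarith
      _ = _ := by ring
  obtain ⟨K, _, hK⟩ := Asymptotics.bound_of_isBigO_nat_atTop hO
  refine ⟨K, fun Q hQ => ?_⟩
  have hpos : 0 < (Q : ℝ) ^ (-(1 / 10 : ℝ) + δ) := by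
    have : 0 < Q := by omega
    positivity
  have := hK hpos.ne'
  rwa [Real.norm_eq_abs, Real.norm_eq_abs, abs_of_pos hpos] at this
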